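/- In the CACTO iteration, the sequence of returned values is pointwise nonincreasing: for every k ∈ ℕ, every t ∈ Fin (T+1), and every state x, V^{TO(π^{k+1})}_t(x) ≤ V^{TO(π^k)}_t(x). -/

import Mathlib

/-- Value function of a policy `π`, defined by backward recursion:
`V^π_T(x) = lT x` and for `t < T`,
`V^π_t(x) = l t x (π t x) + V^π_{t+1}(f t x (π t x))`. -/
def val {S U : Type*} (T : ℕ) (f : Fin T → S → U → S) (l : Fin T → S → U → ℝ)
    (lT : S → ℝ) (π : Fin T → S → U) : Fin (T + 1) → S → ℝ
  | t, x =>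
    if h : (t : ℕ) < T then
      l ⟨t, h⟩ x (π ⟨t, h⟩ x) +
        val T f l lT π ⟨(t : ℕ) + 1, by omega⟩ (f ⟨t, h⟩ x (π ⟨t, h⟩ x))
    else lT x
  termination_by t _ => T - (t : ℕ)
  decreasing_by omega

/-- `π'` is greedy with respect to `W`. -/
def IsGreedy {S U : Type*} (T : ℕ) (f : Fin T → S → U → S) (l : Fin T → S → U → ℝ)
    (π' : Fin T → S → U) (W : Fin (T + 1) → S → ℝ) : Prop :=
  ∀ (t : Fin T) (x : S) (u : U),
    l t x (π' t x) + W t.succ (f t x (π' t x)) ≤ l t x u + W t.succ (f t x u)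

/-- The optimal value function: pointwise minimum of `val` over all (finitely many) policies. -/
noncomputable def optVal {S U : Type*} [Fintype S] [DecidableEq S] [Fintype U] [Nonempty U]
    (T : ℕ) (f : Fin T → S → U → S) (l : Fin T → S → U → ℝ) (lT : S → ℝ) :
    Fin (T + 1) → S → ℝ :=
  fun t x =>
    Finset.univ.inf' Finset.univ_nonempty (fun π : Fin T → S → U => val T f l lT π t x)

theorem val_last {S U : Type*} (T : ℕ) (f : Fin T → S → U → S) (l : Fin T → S → U → ℝ)
    (lT : S → ℝ) (π : Fin T → S → U) (x : S) : val T f l lT π (Fin.last T) x = lT x := by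
  rw [val]
  simp

theorem val_castSucc {S U : Type*} (T : ℕ) (f : Fin T → S → U → S) (l : Fin T → S → U → ℝ)
    (lT : S → ℝ) (π : Fin T → S → U) (t : Fin T) (x : S) :
    val T f l lT π t.castSucc x =
      l t x (π t x) + val T f l lT π t.succ (f t x (π t x)) := by
  rw [val, dif_pos (show (t.castSucc : ℕ) < T from t.isLt)]
  rfl

/-- Policy improvement: a policy greedy with respect to the value function of `p` is pointwise
at least as good as `p`. -/
theorem IsGreedy.val_le {S U : Type*} {T : ℕ} {f : Fin T → S → U → S}
    {l : Fin T → S → U → ℝ} {lT : S → ℝ} {q p : Fin T → S → U}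
    (h : IsGreedy T f l q (val T f l lT p)) (t : Fin (T + 1)) (x : S) :
    val T f l lT q t x ≤ val T f l lT p t x := by
  induction t using Fin.reverseInduction generalizing x with
  | last => rw [val_last, val_last]
  | cast t ih =>
    rw [val_castSucc, val_castSucc]
    exact (add_le_add_right (ih _) _).trans (h t x (p t x))

variable {S U : Type*} [Fintype S] [DecidableEq S] [Nonempty S] [Fintype U] [Nonempty U]
  (T : ℕ) (f : Fin T → S → U → S) (l : Fin T → S → U → ℝ) (lT : S → ℝ)

theorem cacto_values_nonincreasing
    (TO : (Fin T → S → U) → (Fin T → S → U))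
    (hTO : ∀ (p : Fin T → S → U) (t : Fin (T + 1)) (x : S),
      val T f l lT (TO p) t x ≤ val T f l lT p t x)
    (π : ℕ → Fin T → S → U)
    (hgreedy : ∀ k : ℕ, IsGreedy T f l (π (k + 1)) (val T f l lT (TO (π k)))) :
    ∀ (k : ℕ) (t : Fin (T + 1)) (x : S),
      val T f l lT (TO (π (k + 1))) t x ≤ val T f l lT (TO (π k)) t x := by
  intro k t x
  exact (hTO (π (k + 1)) t x).trans ((hgreedy k).val_le t x)
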